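/- arXiv:2010.07090 — 2 statements merged into one kernel-verified Lean document; each statement's English description precedes it below -/
import Mathlib

section
/- Littlewood's theorem for subordination to functions with positive, convex, increasing coefficients: if f(z) = Σ_{n≥1} a_n z^n is subordinate to F(z) = Σ_{n≥1} A_n z^n where the coefficients A_n are positive, increasing (A_{n+1} ≥ A_n), and convex (A_{n+1} - A_n ≥ A_n - A_{n-1}), then |a_n| ≤ A_n for all n ≥ 1. -/
open Metric

open Filter Topology Finset ComplexConjugate

/-- `p` is the Taylor series of `f` at the origin and it converges to `f` on the open unit disc. -/
def HasTaylorOnDisc (f : ℂ → ℂ) (p : PowerSeries ℂ) : Prop :=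
  ∀ z ∈ ball (0 : ℂ) 1, HasSum (fun n => p.coeff n * z ^ n) (f z)

namespace HasTaylorOnDisc

variable {f g : ℂ → ℂ} {p q : PowerSeries ℂ}

theorem congr (hf : HasTaylorOnDisc f p) (h : ∀ z ∈ ball (0 : ℂ) 1, f z = g z) :
    HasTaylorOnDisc g p := fun z hz => h z hz ▸ hf z hz

theorem add (hf : HasTaylorOnDisc f p) (hg : HasTaylorOnDisc g q) :
    HasTaylorOnDisc (fun z => f z + g z) (p + q) := fun z hz => by
  simpa [add_mul] using (hf z hz).add (hg z hz)

theorem mul (hf : HasTaylorOnDisc f p) (hg : HasTaylorOnDisc g q) :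
    HasTaylorOnDisc (fun z => f z * g z) (p * q) := fun z hz => by
  have h := hasSum_sum_range_mul_of_summable_norm (hf z hz).summable.norm (hg z hz).summable.norm
  rw [(hf z hz).tsum_eq, (hg z hz).tsum_eq] at h
  convert! h using 2 with n
  rw [PowerSeries.coeff_mul, Finset.Nat.sum_antidiagonal_eq_sum_range_succ_mk, Finset.sum_mul]
  refine Finset.sum_congr rfl fun k hk => ?_
  rw [← pow_mul_pow_sub z (Nat.lt_succ_iff.mp (Finset.mem_range.mp hk))]
  ring

theorem polynomial (P : Polynomial ℂ) : HasTaylorOnDisc (fun z => P.eval z) (P : PowerSeries ℂ) :=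
  fun z _ => by
    simp only [Polynomial.coeff_coe, Polynomial.eval_eq_sum, Polynomial.sum]
    refine hasSum_sum_of_ne_finset_zero fun n hn => ?_
    simp [Polynomial.notMem_support_iff.mp hn]

theorem pow (hf : HasTaylorOnDisc f p) (n : ℕ) : HasTaylorOnDisc (fun z => f z ^ n) (p ^ n) := by
  induction n with
  | zero => simpa using polynomial 1
  | succ n ih => simpa only [pow_succ] using ih.mul hf

theorem smul (hf : HasTaylorOnDisc f p) (c : ℂ) : HasTaylorOnDisc (fun z => c * f z) (c • p) :=
  fun z hz => by simpa [mul_assoc] using (hf z hz).mul_left c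

theorem sum {ι : Type*} (s : Finset ι) {f : ι → ℂ → ℂ} {p : ι → PowerSeries ℂ}
    (h : ∀ i ∈ s, HasTaylorOnDisc (f i) (p i)) :
    HasTaylorOnDisc (fun z => ∑ i ∈ s, f i z) (∑ i ∈ s, p i) := fun z hz => by
  simpa [Finset.sum_mul] using hasSum_sum fun i hi => h i hi z hz

theorem hasFPowerSeriesOnBall (hf : HasTaylorOnDisc f p) :
    HasFPowerSeriesOnBall f (FormalMultilinearSeries.ofScalars ℂ fun n => p.coeff n) 0 1 := by
  refine ⟨ENNReal.le_of_forall_nnreal_lt fun r hr => ?_, one_pos, fun {y} hy => ?_⟩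
  · have hr1 : (r : ℂ) ∈ ball (0 : ℂ) 1 := by
      simpa using hr
    have h := (hf _ hr1).summable.norm.tendsto_atTop_zero
    refine FormalMultilinearSeries.le_radius_of_tendsto _ (l := 0) ?_
    simpa [FormalMultilinearSeries.ofScalars_norm] using h
  · have hy' : y ∈ ball (0 : ℂ) 1 := by
      rw [← ENNReal.coe_one, eball_coe] at hy
      simpa using hy
    simpa [FormalMultilinearSeries.ofScalars_apply_eq, mul_comm] using hf y hy'

theorem differentiableOn (hf : HasTaylorOnDisc f p) : DifferentiableOn ℂ f (ball 0 1) := by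
  have h := hf.hasFPowerSeriesOnBall.differentiableOn
  rwa [← ENNReal.coe_one, eball_coe] at h

theorem unique (hf : HasTaylorOnDisc f p) (hg : HasTaylorOnDisc f q) : p = q := by
  ext n
  have h := hf.hasFPowerSeriesOnBall.hasFPowerSeriesAt.eq_formalMultilinearSeries
    hg.hasFPowerSeriesOnBall.hasFPowerSeriesAt
  simpa [FormalMultilinearSeries.coeff_ofScalars] using
    congrArg (fun s : FormalMultilinearSeries ℂ ℂ ℂ => s.coeff n) h

theorem exists_of_differentiableOn (hf : DifferentiableOn ℂ f (ball 0 1)) :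
    ∃ p, HasTaylorOnDisc f p := by
  refine ⟨PowerSeries.mk fun n => (n.factorial : ℂ)⁻¹ * iteratedDeriv n f 0, fun z hz => ?_⟩
  simpa [mul_assoc, mul_comm, mul_left_comm] using Complex.hasSum_taylorSeries_on_ball hf hz

theorem circleAverage_conj_pow_mul (hf : HasTaylorOnDisc f p) {r : ℝ} (hr : 0 < r) (hr1 : r < 1)
    (k : ℕ) : Real.circleAverage (fun z => conj z ^ k * f z) 0 r = p.coeff k * r ^ (2 * k) := by
  lift r to NNReal using hr.le
  have hd : DifferentiableOn ℂ f (closedBall 0 r) :=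
    hf.differentiableOn.mono (closedBall_subset_ball hr1)
  have h := (hd.hasFPowerSeriesOnBall hr).hasFPowerSeriesAt.eq_formalMultilinearSeries
    hf.hasFPowerSeriesOnBall.hasFPowerSeriesAt
  have hk := congrArg (fun s : FormalMultilinearSeries ℂ ℂ ℂ => s k fun _ => (1 : ℂ)) h
  have hr' : (r : ℝ) ≠ 0 := hr.ne'
  simp only [cauchyPowerSeries_apply, sub_zero, FormalMultilinearSeries.ofScalars_apply_eq,
    one_pow, smul_eq_mul, mul_one] at hk
  rw [← hk, Real.circleAverage_eq_circleIntegral hr', smul_eq_mul,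
    mul_assoc _ (circleIntegral _ _ _), mul_comm (circleIntegral _ _ _),
    ← circleIntegral.integral_const_mul ((r : ℝ) ^ (2 * k) : ℂ)]
  congr 1
  refine circleIntegral.integral_congr r.2 fun z hz => ?_
  have hz' : ‖z‖ = r := by simpa using hz
  have hz0 : z ≠ 0 := by
    rw [← norm_ne_zero_iff, hz']; exact hr'
  have hc : conj z = (r : ℝ) ^ 2 * (1 / z) := by
    field_simp
    rw [mul_comm, Complex.mul_conj, Complex.normSq_eq_norm_sq, hz']; simp
  simp only [hc, sub_zero, smul_eq_mul, mul_pow, pow_mul]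
  ring

theorem circleAverage_re_conj_trunc_mul (hf : HasTaylorOnDisc f p) {r : ℝ} (hr : 0 < r)
    (hr1 : r < 1) (N : ℕ) :
    Real.circleAverage (fun z => (conj ((p.trunc N).eval z) * f z).re) 0 r =
      ∑ k ∈ range N, ‖p.coeff k‖ ^ 2 * r ^ (2 * k) := by
  have hcont : ContinuousOn f (sphere 0 r) := hf.differentiableOn.continuousOn.mono
    (sphere_subset_closedBall.trans (closedBall_subset_ball hr1))
  have hP (z : ℂ) : conj ((p.trunc N).eval z) * f z =
      ∑ k ∈ range N, conj (p.coeff k) • (conj z ^ k * f z) := by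
    rw [← Polynomial.eval₂_id, PowerSeries.eval₂_trunc_eq_sum_range, map_sum, Finset.sum_mul]
    simp [mul_assoc]
  have hint (k : ℕ) : CircleIntegrable (fun z => conj (p.coeff k) • (conj z ^ k * f z)) 0 r := by
    refine ContinuousOn.circleIntegrable hr.le ?_
    have : ContinuousOn (fun z : ℂ => conj z ^ k) (sphere 0 r) := by fun_prop
    fun_prop
  have hC : Real.circleAverage (fun z => conj ((p.trunc N).eval z) * f z) 0 r =
      ((∑ k ∈ range N, ‖p.coeff k‖ ^ 2 * r ^ (2 * k) : ℝ) : ℂ) := by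
    simp only [hP]
    rw [Real.circleAverage_fun_sum fun k _ => hint k, Complex.ofReal_sum]
    refine Finset.sum_congr rfl fun k _ => ?_
    rw [Real.circleAverage_fun_smul, hf.circleAverage_conj_pow_mul hr hr1, smul_eq_mul,
      ← mul_assoc, mul_comm (conj _), Complex.mul_conj, Complex.normSq_eq_norm_sq]
    push_cast
    rfl
  have h := Complex.reCLM.circleAverage_comp_comm (c := 0) (R := r)
    (f := fun z => conj ((p.trunc N).eval z) * f z)
    (by simp only [hP]; exact CircleIntegrable.fun_sum _ fun k _ => hint k)
  rw [hC] at h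
  exact h

theorem circleAverage_norm_sq_trunc (p : PowerSeries ℂ) {r : ℝ} (hr : 0 < r) (hr1 : r < 1)
    (N : ℕ) : Real.circleAverage (fun z => ‖(p.trunc N).eval z‖ ^ 2) 0 r =
      ∑ k ∈ range N, ‖p.coeff k‖ ^ 2 * r ^ (2 * k) := by
  have h := (polynomial (p.trunc N)).circleAverage_re_conj_trunc_mul hr hr1 N
  rw [PowerSeries.trunc_trunc] at h
  convert h using 2
  · ext z
    rw [mul_comm, Complex.mul_conj, Complex.normSq_eq_norm_sq, Complex.ofReal_re]
  · rename_i k hk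
    rw [Polynomial.coeff_coe, PowerSeries.coeff_trunc, if_pos (Finset.mem_range.mp hk)]

theorem sum_norm_sq_coeff_le_circleAverage (hf : HasTaylorOnDisc f p) {r : ℝ} (hr : 0 < r)
    (hr1 : r < 1) (N : ℕ) :
    ∑ k ∈ range N, ‖p.coeff k‖ ^ 2 * r ^ (2 * k) ≤
      Real.circleAverage (fun z => ‖f z‖ ^ 2) 0 r := by
  have hcont : ContinuousOn f (sphere 0 r) := hf.differentiableOn.continuousOn.mono
    (sphere_subset_closedBall.trans (closedBall_subset_ball hr1))
  have hQ : ContinuousOn (fun z => (p.trunc N).eval z) (sphere (0 : ℂ) r) :=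
    (p.trunc N).continuous.continuousOn
  have h0 : 0 ≤ Real.circleAverage (fun z => ‖f z - (p.trunc N).eval z‖ ^ 2) 0 r :=
    Real.circleAverage_nonneg_of_nonneg fun z _ => by positivity
  have hexp (z : ℂ) : ‖f z - (p.trunc N).eval z‖ ^ 2 =
      ‖f z‖ ^ 2 + ‖(p.trunc N).eval z‖ ^ 2 -
        (2 : ℝ) • (conj ((p.trunc N).eval z) * f z).re := by
    rw [← Complex.normSq_eq_norm_sq, ← Complex.normSq_eq_norm_sq, ← Complex.normSq_eq_norm_sq,
      Complex.normSq_sub, mul_comm (f z), smul_eq_mul]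
  have hconj : ContinuousOn (fun z => conj ((p.trunc N).eval z)) (sphere (0 : ℂ) r) :=
    Complex.continuous_conj.comp_continuousOn hQ
  simp only [hexp] at h0
  rw [Real.circleAverage_fun_sub, Real.circleAverage_fun_add, Real.circleAverage_fun_smul,
    hf.circleAverage_re_conj_trunc_mul hr hr1, circleAverage_norm_sq_trunc p hr hr1,
    smul_eq_mul] at h0
  · linarith
  · exact (hcont.norm.pow 2).circleIntegrable hr.le
  · exact (hQ.norm.pow 2).circleIntegrable hr.le
  · exact ((hcont.norm.pow 2).add (hQ.norm.pow 2)).circleIntegrable hr.le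
  · exact ((Complex.continuous_re.comp_continuousOn (hconj.mul hcont)).const_smul
      (2 : ℝ)).circleIntegrable hr.le

end HasTaylorOnDisc

/-- Multiplication by `p` does not increase the `ℓ²` norm of any initial segment of coefficients. -/
def IsCoeffContraction (p : PowerSeries ℂ) : Prop :=
  ∀ (g : PowerSeries ℂ) (N : ℕ),
    ∑ k ∈ range N, ‖(p * g).coeff k‖ ^ 2 ≤ ∑ k ∈ range N, ‖g.coeff k‖ ^ 2

theorem HasTaylorOnDisc.isCoeffContraction {f : ℂ → ℂ} {p : PowerSeries ℂ}
    (hf : HasTaylorOnDisc f p) (hb : ∀ z ∈ ball (0 : ℂ) 1, ‖f z‖ ≤ 1) :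
    IsCoeffContraction p := fun g N => by
  have hcoeff : ∀ k ∈ range N, (p * (g.trunc N : PowerSeries ℂ)).coeff k = (p * g).coeff k := by
    intro k hk
    rw [PowerSeries.coeff_mul, PowerSeries.coeff_mul]
    refine Finset.sum_congr rfl fun x hx => ?_
    rw [Polynomial.coeff_coe, PowerSeries.coeff_trunc, if_pos]
    have := Finset.HasAntidiagonal.mem_antidiagonal.mp hx
    have := Finset.mem_range.mp hk
    omega
  have key : ∀ r ∈ Set.Ioo (0 : ℝ) 1, ∑ k ∈ range N, ‖(p * g).coeff k‖ ^ 2 * r ^ (2 * k) ≤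
      ∑ k ∈ range N, ‖g.coeff k‖ ^ 2 * r ^ (2 * k) := by
    rintro r ⟨hr, hr1⟩
    have hfg := hf.mul (HasTaylorOnDisc.polynomial (g.trunc N))
    rw [← HasTaylorOnDisc.circleAverage_norm_sq_trunc g hr hr1]
    calc _ = ∑ k ∈ range N, ‖(p * (g.trunc N : PowerSeries ℂ)).coeff k‖ ^ 2 * r ^ (2 * k) :=
          Finset.sum_congr rfl fun k hk => by rw [hcoeff k hk]
      _ ≤ _ := hfg.sum_norm_sq_coeff_le_circleAverage hr hr1 N
      _ ≤ _ := by
        have hsub : sphere (0 : ℂ) r ⊆ ball 0 1 :=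
          sphere_subset_closedBall.trans (closedBall_subset_ball hr1)
        refine Real.circleAverage_mono ?_ ?_ fun z hz => ?_
        · exact ((hfg.differentiableOn.continuousOn.mono hsub).norm.pow 2).circleIntegrable hr.le
        · exact ((g.trunc N).continuous.continuousOn.norm.pow 2).circleIntegrable hr.le
        · rw [abs_of_pos hr] at hz
          rw [norm_mul]
          gcongr
          exact mul_le_of_le_one_left (norm_nonneg _) (hb z (hsub hz))
  have hlim (c : ℕ → ℝ) : Tendsto (fun r : ℝ => ∑ k ∈ range N, c k * r ^ (2 * k)) (𝓝[<] 1)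
      (𝓝 (∑ k ∈ range N, c k)) := by
    have : Continuous fun r : ℝ => ∑ k ∈ range N, c k * r ^ (2 * k) := by fun_prop
    simpa using (this.tendsto 1).mono_left nhdsWithin_le_nhds
  exact le_of_tendsto_of_tendsto (hlim _) (hlim _)
    (Filter.eventually_of_mem (Ioo_mem_nhdsLT one_pos) key)

namespace IsCoeffContraction

variable {p : PowerSeries ℂ}

theorem pow (hp : IsCoeffContraction p) (n : ℕ) : IsCoeffContraction (p ^ n) := by
  induction n with
  | zero => intro g N; simp
  | succ n ih =>
    intro g N
    rw [pow_succ', mul_assoc]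
    exact (hp _ _).trans (ih g N)

theorem norm_coeff_le_one (hp : IsCoeffContraction p) {g : PowerSeries ℂ}
    (hg : (1 - PowerSeries.X * p) * g = 1) (n : ℕ) : ‖g.coeff n‖ ≤ 1 := by
  have hg' : g = 1 + PowerSeries.X * (p * g) := by linear_combination hg
  have h0 : g.coeff 0 = 1 := by rw [hg']; simp
  have hs (k : ℕ) : g.coeff (k + 1) = (p * g).coeff k := by
    conv_lhs => rw [hg']
    simp [PowerSeries.coeff_one]
  have h := Finset.sum_range_succ' (fun k => ‖g.coeff k‖ ^ 2) n
  rw [Finset.sum_range_succ] at h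
  simp only [hs, h0, norm_one] at h
  have := hp g n
  refine (sq_le_one_iff₀ (norm_nonneg _)).mp ?_
  linarith

theorem sum_norm_sq_coeff_le (hp : IsCoeffContraction p) {g : PowerSeries ℂ}
    (hg : (1 - PowerSeries.X * p) * g = 1) (n : ℕ) :
    ∑ k ∈ range n, ‖g.coeff k‖ ^ 2 ≤ n := by
  simpa using Finset.sum_le_card_nsmul (range n) (fun k => ‖g.coeff k‖ ^ 2) 1 fun k _ =>
    (sq_le_one_iff₀ (norm_nonneg _)).mpr (hp.norm_coeff_le_one hg k)

end IsCoeffContraction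

theorem PowerSeries.norm_coeff_mul_le_of_sum_norm_sq_le {g h : PowerSeries ℂ} {n : ℕ} {C : ℝ}
    (hg : ∑ k ∈ range (n + 1), ‖g.coeff k‖ ^ 2 ≤ C)
    (hh : ∑ k ∈ range (n + 1), ‖h.coeff k‖ ^ 2 ≤ C) : ‖(g * h).coeff n‖ ≤ C := by
  rw [PowerSeries.coeff_mul, Finset.Nat.sum_antidiagonal_eq_sum_range_succ_mk]
  rw [← Finset.sum_range_reflect] at hh
  calc _ ≤ ∑ k ∈ range (n + 1), ‖g.coeff k * h.coeff (n - k)‖ := norm_sum_le _ _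
    _ ≤ ∑ k ∈ range (n + 1), (‖g.coeff k‖ ^ 2 + ‖h.coeff (n + 1 - 1 - k)‖ ^ 2) / 2 := by
      refine Finset.sum_le_sum fun k _ => ?_
      rw [norm_mul, Nat.add_sub_cancel]
      linarith [two_mul_le_add_sq ‖g.coeff k‖ ‖h.coeff (n - k)‖]
    _ ≤ C := by
      rw [← Finset.sum_div, Finset.sum_add_distrib]
      linarith

theorem PowerSeries.coeff_X_mul_pow_mul_of_lt {R : Type*} [CommRing R] (p q : PowerSeries R)
    {m n : ℕ} (h : n < m) : ((X * p) ^ m * q).coeff n = 0 := by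
  rw [mul_pow, mul_assoc, coeff_X_pow_mul', if_neg h.not_ge]

namespace IsCoeffContraction

open PowerSeries

variable {p : PowerSeries ℂ}

theorem exists_inverse (p : PowerSeries ℂ) : ∃ g : PowerSeries ℂ, (1 - X * p) * g = 1 :=
  ⟨(1 - X * p)⁻¹, PowerSeries.mul_inv_cancel _ (by simp)⟩

theorem norm_sum_coeff_pow_le_one (hp : IsCoeffContraction p) (N : ℕ) :
    ‖∑ k ∈ range (N + 1), ((X * p) ^ (k + 1)).coeff (N + 1)‖ ≤ 1 := by
  obtain ⟨g, hg⟩ := exists_inverse p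
  have hsum : ∑ k ∈ range (N + 1), (X * p) ^ (k + 1) = g - 1 - (X * p) ^ (N + 2) * g := by
    have h := Finset.sum_range_succ' (fun k => (X * p) ^ k) (N + 1)
    have h' := mul_neg_geom_sum (X * p) (N + 2)
    linear_combination -h + g * h' - (∑ k ∈ range (N + 2), (X * p) ^ k) * hg
  rw [← map_sum, hsum, map_sub, map_sub, coeff_X_mul_pow_mul_of_lt _ _ (by omega)]
  simpa [PowerSeries.coeff_one] using hp.norm_coeff_le_one hg (N + 1)

theorem norm_sum_sub_mul_coeff_pow_le (hp : IsCoeffContraction p) {N j : ℕ} (hj : j < N) :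
    ‖∑ k ∈ range (N + 1), (((k - j : ℕ) : ℝ) : ℂ) * ((X * p) ^ (k + 1)).coeff (N + 1)‖ ≤
      ((N - j : ℕ) : ℝ) := by
  obtain ⟨g, hg⟩ := exists_inverse p
  obtain ⟨m, rfl⟩ : ∃ m, N = j + (m + 1) := ⟨N - j - 1, by omega⟩
  have hsum (M : ℕ) : (∑ i ∈ range (M + 1), (i : PowerSeries ℂ) * (X * p) ^ i) *
      (1 - X * p) ^ 2 = X * p + (X * p) ^ (M + 1) * ((M : PowerSeries ℂ) * (X * p) - ((M : PowerSeries ℂ) + 1)) := by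
    induction M with
    | zero => simp
    | succ M ih =>
      rw [Finset.sum_range_succ, add_mul, ih]
      push_cast
      ring
  have hg2 : (1 - X * p) ^ 2 * g ^ 2 = 1 := by rw [← mul_pow, hg, one_pow]
  have hsum' : p ^ (j + 1) * ∑ i ∈ range (m + 1 + 1), (i : PowerSeries ℂ) * (X * p) ^ i =
      X * (p ^ (j + 2) * g * g) + (X * p) ^ (m + 2) *
        (p ^ (j + 1) * (((m + 1 : ℕ) : PowerSeries ℂ) * (X * p) -
          (((m + 1 : ℕ) : PowerSeries ℂ) + 1)) * g ^ 2) := by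
    linear_combination p ^ (j + 1) * g ^ 2 * hsum (m + 1) -
      p ^ (j + 1) * (∑ i ∈ range (m + 1 + 1), (i : PowerSeries ℂ) * (X * p) ^ i) * hg2
  have hcoeff : ∑ k ∈ range (j + (m + 1) + 1), (((k - j : ℕ) : ℝ) : ℂ) *
      ((X * p) ^ (k + 1)).coeff (j + (m + 1) + 1) = (p ^ (j + 2) * g * g).coeff m := by
    calc _ = (X ^ (j + 1) * (p ^ (j + 1) * ∑ i ∈ range (m + 1 + 1),
          (i : PowerSeries ℂ) * (X * p) ^ i)).coeff (m + 1 + (j + 1)) := by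
          rw [add_assoc j, Finset.sum_range_add, Finset.sum_eq_zero, zero_add, ← mul_assoc,
            ← mul_pow, Finset.mul_sum, map_sum]
          · refine Finset.sum_congr rfl fun i _ => ?_
            rw [Nat.add_sub_cancel_left, Complex.ofReal_natCast, mul_left_comm, ← pow_add,
              ← nsmul_eq_mul, ← nsmul_eq_mul, map_nsmul]
            congr 3 <;> ring_nf
          · intro k hk
            simp [Nat.sub_eq_zero_of_le (Finset.mem_range.mp hk).le]
      _ = _ := by
        rw [coeff_X_pow_mul, hsum', map_add, coeff_X_mul_pow_mul_of_lt _ _ (by omega), add_zero,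
          coeff_succ_X_mul]
  rw [hcoeff, Nat.add_sub_cancel_left]
  refine norm_coeff_mul_le_of_sum_norm_sq_le ?_ (hp.sum_norm_sq_coeff_le hg _)
  exact (hp.pow _ g _).trans (hp.sum_norm_sq_coeff_le hg _)

end IsCoeffContraction

/-- A convex increasing sequence is a nonnegative combination of a constant and truncated
linear sequences. -/
theorem exists_nonneg_combination_of_convex {B : ℕ → ℝ} (h1 : B 0 ≤ B 1)
    (h2 : ∀ k, B (k + 1) - B k ≤ B (k + 2) - B (k + 1)) :
    ∃ d : ℕ → ℝ, (∀ j, 0 ≤ d j) ∧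
      ∀ N, ∀ k ≤ N, B k = B 0 + ∑ j ∈ range N, d j * ((k - j : ℕ) : ℝ) := by
  let d : ℕ → ℝ := fun j =>
    Nat.casesOn j (B 1 - B 0) fun i => B (i + 2) - B (i + 1) - (B (i + 1) - B i)
  have hdiff (k : ℕ) : B (k + 1) - B k = ∑ j ∈ range (k + 1), d j := by
    induction k with
    | zero => simp [d]
    | succ k ih => rw [Finset.sum_range_succ, ← ih]; simp [d]
  have hB (k : ℕ) : B k = B 0 + ∑ j ∈ range k, d j * ((k - j : ℕ) : ℝ) := by
    induction k with
    | zero => simp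
    | succ k ih =>
      have hstep : ∑ j ∈ range (k + 1), d j * ((k + 1 - j : ℕ) : ℝ) =
          ∑ j ∈ range (k + 1), d j * ((k - j : ℕ) : ℝ) + ∑ j ∈ range (k + 1), d j := by
        rw [← Finset.sum_add_distrib]
        refine Finset.sum_congr rfl fun j hj => ?_
        rw [Nat.succ_sub (Nat.lt_succ_iff.mp (Finset.mem_range.mp hj))]
        push_cast
        ring
      rw [hstep, ← hdiff, Finset.sum_range_succ, Nat.sub_self, Nat.cast_zero, mul_zero, add_zero]
      linarith
  refine ⟨d, fun j => ?_, fun N k hk => ?_⟩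
  · cases j with
    | zero => simpa [d] using h1
    | succ i => simpa [d] using h2 i
  · rw [hB k]
    congr 1
    refine Finset.sum_subset (Finset.range_mono hk) fun j _ hj => ?_
    simp [Nat.sub_eq_zero_of_le (not_lt.mp (mt Finset.mem_range.mpr hj))]

theorem norm_sum_convex_mul_le {B : ℕ → ℝ} (h0 : 0 ≤ B 0) (h1 : B 0 ≤ B 1)
    (h2 : ∀ k, B (k + 1) - B k ≤ B (k + 2) - B (k + 1)) {e : ℕ → ℂ} {N : ℕ}
    (he : ‖∑ k ∈ range (N + 1), e k‖ ≤ 1)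
    (hej : ∀ j < N, ‖∑ k ∈ range (N + 1), (((k - j : ℕ) : ℝ) : ℂ) * e k‖ ≤ ((N - j : ℕ) : ℝ)) :
    ‖∑ k ∈ range (N + 1), (B k : ℂ) * e k‖ ≤ B N := by
  obtain ⟨d, hd, hB⟩ := exists_nonneg_combination_of_convex h1 h2
  have hsum : ∑ k ∈ range (N + 1), (B k : ℂ) * e k = B 0 * ∑ k ∈ range (N + 1), e k +
      ∑ j ∈ range N, (d j : ℂ) * ∑ k ∈ range (N + 1), (((k - j : ℕ) : ℝ) : ℂ) * e k := by
    simp only [Finset.mul_sum]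
    rw [Finset.sum_comm, ← Finset.sum_add_distrib]
    refine Finset.sum_congr rfl fun k hk => ?_
    rw [hB N k (Nat.lt_succ_iff.mp (Finset.mem_range.mp hk)), Complex.ofReal_add,
      Complex.ofReal_sum, add_mul, Finset.sum_mul]
    simp only [Complex.ofReal_mul, mul_assoc]
  rw [hsum, hB N N le_rfl]
  refine (norm_add_le _ _).trans (add_le_add ?_ ((norm_sum_le _ _).trans ?_))
  · rw [norm_mul, Complex.norm_of_nonneg h0]
    exact mul_le_of_le_one_right h0 he
  · refine Finset.sum_le_sum fun j hj => ?_
    rw [norm_mul, Complex.norm_of_nonneg (hd j)]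
    exact mul_le_mul_of_nonneg_left (hej j (Finset.mem_range.mp hj)) (hd j)

/-- The coefficients of `F ∘ φ`, with `φ z = z ψ(z)`, computed from those of `F` and `ψ`. -/
theorem HasTaylorOnDisc.coeff_comp {f F ψ : ℂ → ℂ} {a A p : PowerSeries ℂ}
    (hψ : HasTaylorOnDisc ψ p) (hmaps : ∀ z ∈ ball (0 : ℂ) 1, z * ψ z ∈ ball (0 : ℂ) 1)
    (hf : HasTaylorOnDisc f a) (hF : HasTaylorOnDisc F A)
    (hsub : ∀ z ∈ ball (0 : ℂ) 1, f z = F (z * ψ z)) (n : ℕ) :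
    a.coeff n = ∑ k ∈ range (n + 1), A.coeff k * ((PowerSeries.X * p) ^ k).coeff n := by
  have hX : HasTaylorOnDisc (fun z => z) PowerSeries.X := by simpa using polynomial Polynomial.X
  have hφ := hX.mul hψ
  let G : ℂ → ℂ := fun w => ∑' k, A.coeff (k + (n + 1)) * w ^ k
  have hG : HasTaylorOnDisc G (PowerSeries.mk fun k => A.coeff (k + (n + 1))) := fun w hw => by
    simp only [PowerSeries.coeff_mk]
    refine Summable.hasSum ?_
    rcases eq_or_ne w 0 with rfl | hw0
    · exact summable_of_ne_finset_zero (s := {0}) fun k hk => by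
        simp [Finset.notMem_singleton.mp hk]
    · have h := ((summable_nat_add_iff (n + 1)).mpr (hF w hw).summable).mul_right
        ((w ^ (n + 1))⁻¹)
      refine h.congr fun k => ?_
      rw [pow_add, ← mul_assoc, mul_inv_cancel_right₀ (pow_ne_zero _ hw0)]
  have hFG (w : ℂ) (hw : w ∈ ball (0 : ℂ) 1) :
      F w = ∑ k ∈ range (n + 1), A.coeff k * w ^ k + w ^ (n + 1) * G w := by
    rw [← (hF w hw).tsum_eq, ← (hF w hw).summable.sum_add_tsum_nat_add (n + 1), ← tsum_mul_left]
    congr 2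
    ext k
    ring
  obtain ⟨q, hq⟩ := exists_of_differentiableOn
    (hG.differentiableOn.comp hφ.differentiableOn hmaps)
  have hsum := (HasTaylorOnDisc.sum (range (n + 1)) fun k _ => (hφ.pow k).smul (A.coeff k)).add
    ((hφ.pow (n + 1)).mul hq)
  rw [hf.unique (hsum.congr fun z hz => by rw [hsub z hz, hFG _ (hmaps z hz)]; rfl), map_add,
    PowerSeries.coeff_X_mul_pow_mul_of_lt _ _ n.lt_succ_self, add_zero, map_sum]
  simp

/-- Littlewood's theorem: if `f = ∑_{n≥1} a_n z^n` is subordinate to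
`F = ∑_{n≥1} A_n z^n` where the `A_n` (for `n ≥ 1`) are positive, increasing and
convex, then `|a_n| ≤ A_n` for all `n ≥ 1`. -/
theorem littlewood_subordination_convex_coeffs
    (f F φ : ℂ → ℂ) (a : ℕ → ℂ) (A : ℕ → ℝ)
    (hφ : AnalyticOn ℂ φ (ball (0 : ℂ) 1))
    (hφmaps : Set.MapsTo φ (ball (0 : ℂ) 1) (ball (0 : ℂ) 1))
    (hφ0 : φ 0 = 0)
    (hsub : ∀ z ∈ ball (0 : ℂ) 1, f z = F (φ z))
    (ha0 : a 0 = 0) (hA0 : A 0 = 0)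
    (hf : ∀ z ∈ ball (0 : ℂ) 1, HasSum (fun n => a n * z ^ n) (f z))
    (hF : ∀ z ∈ ball (0 : ℂ) 1, HasSum (fun n => (A n : ℂ) * z ^ n) (F z))
    (hApos : ∀ n ≥ 1, 0 < A n)
    (hAincr : ∀ n ≥ 1, A n ≤ A (n + 1))
    (hAconvex : ∀ n ≥ 2, A n - A (n - 1) ≤ A (n + 1) - A n) :
    ∀ n ≥ 1, ‖a n‖ ≤ A n := by
  intro n hn
  obtain ⟨N, rfl⟩ := Nat.exists_eq_add_of_le' hn
  have hd : DifferentiableOn ℂ φ (ball 0 1) := hφ.differentiableOn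
  have hψd : DifferentiableOn ℂ (dslope φ 0) (ball 0 1) :=
    (Complex.differentiableOn_dslope (ball_mem_nhds 0 one_pos)).mpr hd
  have hψb (z : ℂ) (hz : z ∈ ball (0 : ℂ) 1) : ‖dslope φ 0 z‖ ≤ 1 := by
    have hm : Set.MapsTo φ (ball 0 1) (closedBall (φ 0) 1) := by
      rw [hφ0]
      exact fun w hw => ball_subset_closedBall (hφmaps hw)
    simpa using Complex.norm_dslope_le_div_of_mapsTo_ball hd hm hz
  have hφψ (z : ℂ) : z * dslope φ 0 z = φ z := by
    simpa [hφ0] using sub_smul_dslope φ 0 z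
  obtain ⟨p, hp⟩ := HasTaylorOnDisc.exists_of_differentiableOn hψd
  have hc := hp.isCoeffContraction hψb
  have hcoeff := hp.coeff_comp (f := f) (F := F) (a := PowerSeries.mk a)
    (A := PowerSeries.mk fun n => (A n : ℂ)) (fun z hz => by rw [hφψ]; exact hφmaps hz)
    (fun z hz => by simpa using hf z hz) (fun z hz => by simpa using hF z hz)
    (fun z hz => by rw [hφψ]; exact hsub z hz) (N + 1)
  simp only [PowerSeries.coeff_mk] at hcoeff
  rw [hcoeff, Finset.sum_range_succ', hA0, Complex.ofReal_zero, zero_mul, add_zero]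
  exact norm_sum_convex_mul_le (B := fun k => A (k + 1)) (hApos 1 le_rfl).le (hAincr 1 le_rfl)
    (fun k => hAconvex (k + 2) (by omega)) (hc.norm_sum_coeff_pow_le_one N)
    fun j hj => hc.norm_sum_sub_mul_coeff_pow_le hj
end

section
/- The elliptic modular function J(z) = 16 z ∏_{n=1}^∞ ((1+z^{2n})/(1+z^{2n-1}))^8 is analytic on the unit disk, vanishes only at z = 0, and omits the values 0 and 1 on the punctured disk 0 < |z| < 1. -/
open Metric

/-- The elliptic modular function as an infinite product. -/
noncomputable def modularJ (z : ℂ) : ℂ :=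
  16 * z * ∏' n : ℕ, ((1 + z ^ (2 * (n + 1))) / (1 + z ^ (2 * (n + 1) - 1))) ^ 8

open Filter Topology

/-- The infinite `q`-Pochhammer symbol `(-a; p)_∞`. -/
noncomputable def qProd (a p : ℂ) : ℂ := ∏' n : ℕ, (1 + a * p ^ n)

lemma norm_sq_lt_one {p : ℂ} (hp : ‖p‖ < 1) : ‖p ^ 2‖ < 1 := by
  rw [norm_pow]
  exact pow_lt_one₀ (norm_nonneg _) hp two_ne_zero

lemma summable_norm_mul_pow (a : ℂ) {p : ℂ} (hp : ‖p‖ < 1) :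
    Summable fun n : ℕ ↦ ‖a * p ^ n‖ := by
  simpa using (summable_geometric_of_lt_one (norm_nonneg _) hp).mul_left ‖a‖

lemma hasProd_qProd (a : ℂ) {p : ℂ} (hp : ‖p‖ < 1) :
    HasProd (fun n : ℕ ↦ 1 + a * p ^ n) (qProd a p) :=
  (multipliable_one_add_of_summable (summable_norm_mul_pow a hp)).hasProd

lemma qProd_ne_zero {a p : ℂ} (hp : ‖p‖ < 1) (h : ∀ n : ℕ, 1 + a * p ^ n ≠ 0) :
    qProd a p ≠ 0 :=
  tprod_one_add_ne_zero_of_summable h (summable_norm_mul_pow a hp)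

lemma one_add_mul_pow_ne_zero {a p : ℂ} (ha : ‖a‖ < 1) (hp : ‖p‖ ≤ 1) (n : ℕ) :
    1 + a * p ^ n ≠ 0 := by
  intro h
  have h1 : ‖a * p ^ n‖ < 1 := by
    rw [norm_mul, norm_pow]
    exact mul_lt_one_of_nonneg_of_lt_one_left (norm_nonneg _) ha
      (pow_le_one₀ (norm_nonneg _) hp)
  rw [eq_neg_of_add_eq_zero_right h] at h1
  simp at h1

lemma qProd_even_odd (a : ℂ) {p : ℂ} (hp : ‖p‖ < 1) :
    qProd a p = qProd a (p ^ 2) * qProd (a * p) (p ^ 2) := by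
  refine (hasProd_qProd a hp).unique (HasProd.even_mul_odd ?_ ?_)
  · simpa [pow_mul] using hasProd_qProd a (norm_sq_lt_one hp)
  · convert hasProd_qProd (a * p) (norm_sq_lt_one hp) using 2 with n
    ring

lemma qProd_mul_neg (a : ℂ) {p : ℂ} (hp : ‖p‖ < 1) :
    qProd a p * qProd (-a) p = qProd (-a ^ 2) (p ^ 2) := by
  refine ((hasProd_qProd a hp).mul (hasProd_qProd (-a) hp)).unique ?_
  convert hasProd_qProd (-a ^ 2) (norm_sq_lt_one hp) using 2 with n
  ring

lemma qProd_eq_mul (a : ℂ) {p : ℂ} (hp : ‖p‖ < 1) :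
    qProd a p = (1 + a) * qProd (a * p) p := by
  refine (hasProd_qProd a hp).unique ?_
  convert HasProd.zero_mul (f := fun n : ℕ ↦ 1 + a * p ^ n) (m := qProd (a * p) p) ?_ using 1
  · simp
  · convert hasProd_qProd (a * p) hp using 2 with n
    ring

/-- Reciprocal of the finite `q`-Pochhammer symbol `(p; p)_m`, extended by zero to `m < 0`. -/
noncomputable def invPoch (p : ℂ) (m : ℤ) : ℂ :=
  if 0 ≤ m then (∏ i ∈ Finset.range m.toNat, (1 + -p * p ^ i))⁻¹ else 0

lemma invPoch_sub_one {p : ℂ} (hp : ‖p‖ < 1) (hp0 : p ≠ 0) (m : ℤ) :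
    invPoch p (m - 1) = (1 - p ^ m) * invPoch p m := by
  rcases lt_trichotomy m 0 with h | rfl | h
  · simp only [invPoch, not_le.2 h, not_le.2 (show m - 1 < 0 by lia), if_false, mul_zero]
  · simp [invPoch]
  · obtain ⟨k, rfl⟩ : ∃ k : ℕ, m = k + 1 := ⟨(m - 1).toNat, by lia⟩
    have h1 := one_add_mul_pow_ne_zero (a := -p) (by simpa) hp.le k
    have h2 : (1 : ℂ) - p ^ ((k : ℤ) + 1) = 1 + -p * p ^ k := by
      rw [zpow_add₀ hp0]; simp; ring
    have h3 : ((k : ℤ) + 1).toNat = k + 1 := by lia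
    rw [h2]
    simp only [invPoch, h.le, h3, add_sub_cancel_right, Finset.prod_range_succ, if_true,
      Int.natCast_nonneg, Int.toNat_natCast, mul_inv]
    rw [mul_left_comm, mul_inv_cancel₀ h1, mul_one]

lemma tendsto_invPoch {p : ℂ} (hp : ‖p‖ < 1) :
    Tendsto (invPoch p) atTop (𝓝 (qProd (-p) p)⁻¹) := by
  have h0 := qProd_ne_zero hp (one_add_mul_pow_ne_zero (a := -p) (by simpa) hp.le)
  have h1 := ((hasProd_qProd (-p) hp).tendsto_prod_nat.inv₀ h0).comp
    (tendsto_atTop.2 fun b ↦ (eventually_ge_atTop (b : ℤ)).mono fun m hm ↦ by lia :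
      Tendsto Int.toNat atTop atTop)
  refine h1.congr' ?_
  filter_upwards [eventually_ge_atTop 0] with m hm
  simp [invPoch, hm]

lemma exists_norm_invPoch_le {p : ℂ} (hp : ‖p‖ < 1) : ∃ K, 0 ≤ K ∧ ∀ m, ‖invPoch p m‖ ≤ K := by
  have h1 := (tendsto_invPoch hp).comp tendsto_natCast_atTop_atTop
  obtain ⟨K, hK⟩ := (isBounded_range_of_tendsto _ h1).exists_norm_le
  refine ⟨K, (norm_nonneg _).trans (hK _ ⟨0, rfl⟩), fun m ↦ ?_⟩
  by_cases hm : 0 ≤ m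
  · exact hK _ ⟨m.toNat, by simp [hm]⟩
  · simpa [invPoch, hm] using (norm_nonneg _).trans (hK _ ⟨0, rfl⟩)

/-- A finite form of the Jacobi triple product, due to Cauchy and Gauss. -/
lemma hasSum_finite_triple_product {q x : ℂ} (hq : ‖q‖ < 1) (hq0 : q ≠ 0) (hx : x ≠ 0) (N : ℕ) :
    HasSum (fun k : ℤ ↦ (∏ i ∈ Finset.range (2 * N), (1 + -q ^ 2 * (q ^ 2) ^ i)) *
        invPoch (q ^ 2) (N - k) * invPoch (q ^ 2) (N + k) * (q ^ (k ^ 2) * x ^ k))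
      (∏ i ∈ Finset.range N, (1 + x * q * (q ^ 2) ^ i) * (1 + x⁻¹ * q * (q ^ 2) ^ i)) := by
  induction N with
  | zero =>
    convert hasSum_single (0 : ℤ) ?_ using 1
    · simp [invPoch]
    · intro k hk
      rcases hk.lt_or_gt with h | h
      · simp [invPoch, not_le.2 h]
      · simp [invPoch, not_le.2 h]
  | succ N ih =>
    have hm := (Equiv.subRight (1 : ℤ)).hasSum_iff.2 ih
    have hp := (Equiv.addRight (1 : ℤ)).hasSum_iff.2 ih
    have key := ((ih.mul_left (1 + (q ^ (2 * N + 1)) ^ 2)).add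
      (hm.mul_left (q ^ (2 * N + 1) * x))).add (hp.mul_left (q ^ (2 * N + 1) * x⁻¹))
    have hprod : ∏ i ∈ Finset.range (N + 1), (1 + x * q * (q ^ 2) ^ i) * (1 + x⁻¹ * q * (q ^ 2) ^ i)
        = (1 + (q ^ (2 * N + 1)) ^ 2) *
            ∏ i ∈ Finset.range N, (1 + x * q * (q ^ 2) ^ i) * (1 + x⁻¹ * q * (q ^ 2) ^ i) +
          q ^ (2 * N + 1) * x *
            ∏ i ∈ Finset.range N, (1 + x * q * (q ^ 2) ^ i) * (1 + x⁻¹ * q * (q ^ 2) ^ i) +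
          q ^ (2 * N + 1) * x⁻¹ *
            ∏ i ∈ Finset.range N, (1 + x * q * (q ^ 2) ^ i) * (1 + x⁻¹ * q * (q ^ 2) ^ i) := by
      rw [Finset.prod_range_succ]
      field_simp
      ring
    rw [hprod]
    refine key.congr_fun fun k ↦ ?_
    have e1 : (N : ℤ) - (k - 1) = N + 1 - k := by ring
    have e2 : (N : ℤ) + (k - 1) = N + 1 + k - 1 - 1 := by ring
    have e3 : (N : ℤ) - (k + 1) = N + 1 - k - 1 - 1 := by ring
    have e4 : (N : ℤ) + (k + 1) = N + 1 + k := by ring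
    have e5 : (N : ℤ) - k = N + 1 - k - 1 := by ring
    have e6 : (N : ℤ) + k = N + 1 + k - 1 := by ring
    have e7 : (k - 1) ^ 2 = k ^ 2 - k - k + 1 := by ring
    have e8 : (k + 1) ^ 2 = k ^ 2 + k + k + 1 := by ring
    have hpq : q ^ 2 ≠ 0 := pow_ne_zero _ hq0
    have hQ : q ^ k ≠ 0 := zpow_ne_zero _ hq0
    have hX : x ^ k ≠ 0 := zpow_ne_zero _ hx
    simp only [Function.comp, Equiv.subRight_apply, Equiv.coe_addRight, e1, e2, e3, e4, e7, e8,
      Nat.cast_add, Nat.cast_one]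
    rw [e5, e6]
    simp only [invPoch_sub_one (norm_sq_lt_one hq) hpq, Nat.mul_add, Finset.prod_range_succ, mul_one,
      zpow_add₀ hpq, zpow_sub₀ hpq, zpow_add₀ hq0, zpow_sub₀ hq0, zpow_add₀ hx, zpow_sub₀ hx,
      zpow_natCast, zpow_one]
    have hk : (q ^ 2) ^ k = q ^ k * q ^ k := by
      rw [← mul_zpow, sq]
    rw [hk]
    generalize invPoch (q ^ 2) _ = u
    generalize invPoch (q ^ 2) _ = v
    generalize (∏ i ∈ Finset.range (2 * N), (1 + -q ^ 2 * (q ^ 2) ^ i)) = G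
    generalize q ^ k = Q at *
    generalize q ^ (k ^ 2) = S at *
    generalize x ^ k = X at *
    field_simp
    ring

lemma summable_norm_theta {q : ℂ} (x : ℂ) (hq : ‖q‖ < 1) :
    Summable fun k : ℤ ↦ ‖q ^ (k ^ 2) * x ^ k‖ := by
  have aux (s : ℝ) (hs : 0 ≤ s) : Summable fun n : ℕ ↦ (‖q‖ ^ n * s) ^ n := by
    have h1 : Tendsto (fun n : ℕ ↦ ‖q‖ ^ n * s) atTop (𝓝 0) := by
      simpa using (tendsto_pow_atTop_nhds_zero_of_lt_one (norm_nonneg q) hq).mul_const s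
    refine Summable.of_norm_bounded_eventually_nat (summable_geometric_of_lt_one
      (r := 1 / 2) (by norm_num) (by norm_num)) ?_
    filter_upwards [h1.eventually (ge_mem_nhds (show (0 : ℝ) < 1 / 2 by norm_num))] with n hn
    rw [Real.norm_of_nonneg (by positivity)]
    gcongr
  refine Summable.of_nat_of_neg ?_ ?_
  · refine (aux ‖x‖ (norm_nonneg _)).congr fun n ↦ ?_
    rw [mul_pow, ← pow_mul, ← sq, norm_mul, zpow_natCast, norm_pow, ← norm_pow]
    norm_cast
  · refine (aux ‖x⁻¹‖ (norm_nonneg _)).congr fun n ↦ ?_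
    rw [mul_pow, ← pow_mul, ← sq, norm_mul, zpow_neg, zpow_natCast, neg_sq, ← inv_pow, norm_pow]
    norm_cast
    simp

/-- The **Jacobi triple product** identity. -/
lemma hasSum_triple_product {q x : ℂ} (hq : ‖q‖ < 1) (hq0 : q ≠ 0) (hx : x ≠ 0) :
    HasSum (fun k : ℤ ↦ q ^ (k ^ 2) * x ^ k)
      (qProd (-q ^ 2) (q ^ 2) * (qProd (x * q) (q ^ 2) * qProd (x⁻¹ * q) (q ^ 2))) := by
  have hp := norm_sq_lt_one hq
  have hD : qProd (-q ^ 2) (q ^ 2) ≠ 0 :=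
    qProd_ne_zero hp (one_add_mul_pow_ne_zero (by simpa using hp) hp.le)
  obtain ⟨K, hK0, hK⟩ := exists_norm_invPoch_le hp
  have hG : Tendsto (fun N : ℕ ↦ ∏ i ∈ Finset.range (2 * N), (1 + -q ^ 2 * (q ^ 2) ^ i)) atTop
      (𝓝 (qProd (-q ^ 2) (q ^ 2))) :=
    (hasProd_qProd (-q ^ 2) hp).tendsto_prod_nat.comp
      (tendsto_id.const_mul_atTop' (by norm_num : 0 < 2))
  obtain ⟨L, hL⟩ := (Metric.isBounded_range_of_tendsto _ hG).exists_norm_le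
  have hL' (N : ℕ) := hL _ ⟨N, rfl⟩
  have hL0 : 0 ≤ L := (norm_nonneg _).trans (hL' 0)
  have hterm (k : ℤ) := ((hG.mul ((tendsto_invPoch hp).comp
    (tendsto_atTop_add_const_right _ (-k) tendsto_natCast_atTop_atTop))).mul
    ((tendsto_invPoch hp).comp (tendsto_atTop_add_const_right _ k
      tendsto_natCast_atTop_atTop))).mul_const (q ^ (k ^ 2) * x ^ k)
  have h1 := tendsto_tsum_of_dominated_convergence
    ((summable_norm_theta x hq).mul_left (L * K * K)) hterm (.of_forall fun N k ↦ by
      rw [norm_mul, norm_mul, norm_mul]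
      gcongr
      exacts [hL' N, hK _, hK _])
  have h2 := ((hasProd_qProd (x * q) hp).mul (hasProd_qProd (x⁻¹ * q) hp)).tendsto_prod_nat
  have h3 := tendsto_nhds_unique (h2.congr fun N ↦
    (hasSum_finite_triple_product hq hq0 hx N).tsum_eq.symm.trans
      (tsum_congr fun k ↦ by simp [sub_eq_add_neg])) h1
  rw [tsum_mul_left, mul_inv_cancel₀ hD, one_mul] at h3
  rw [h3, mul_inv_cancel_left₀ hD]
  exact (summable_norm_theta x hq).of_norm.hasSum

lemma HasSum.mul_of_complex {f g : ℤ → ℂ} {a b : ℂ} (hf : HasSum f a) (hg : HasSum g b) :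
    HasSum (fun p : ℤ × ℤ ↦ f p.1 * g p.2) (a * b) :=
  hf.mul hg (summable_mul_of_summable_norm hf.summable.norm hg.summable.norm)

section Theta

variable {q a b c d : ℂ}

lemma theta_sq_add_sq (hq0 : q ≠ 0) (ha : HasSum (fun k : ℤ ↦ q ^ (k ^ 2)) a)
    (hb : HasSum (fun k : ℤ ↦ q ^ (k ^ 2) * (-1) ^ k) b)
    (hc : HasSum (fun k : ℤ ↦ (q ^ 2) ^ (k ^ 2)) c) : a * a + b * b = 2 * (c * c) := by
  have h1 := (ha.mul_of_complex ha).add (hb.mul_of_complex hb)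
  have h2 := (hc.mul_of_complex hc).mul_left 2
  let g : ℤ × ℤ → ℤ × ℤ := fun p ↦ (p.1 + p.2, p.1 - p.2)
  have hg : Function.Injective g := by
    rintro ⟨m, n⟩ ⟨m', n'⟩ h
    simp only [g, Prod.mk.injEq] at h ⊢
    lia
  refine ((hg.hasSum_iff ?_).2 h1).unique (h2.congr_fun ?_)
  · rintro ⟨m, n⟩ h
    have hodd : Odd (m + n) := by
      by_contra hne
      obtain ⟨r, hr⟩ := Int.not_odd_iff_even.1 hne
      exact h ⟨(r, r - n), by simp only [g, Prod.mk.injEq]; lia⟩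
    have : (-1 : ℂ) ^ m * (-1) ^ n = -1 := by
      rw [← zpow_add₀ (by norm_num), hodd.neg_one_zpow]
    linear_combination q ^ (m ^ 2) * q ^ (n ^ 2) * this
  · rintro ⟨m, n⟩
    have h3 : (-1 : ℂ) ^ (m + n) * (-1) ^ (m - n) = 1 := by
      rw [← zpow_add₀ (by norm_num), Even.neg_one_zpow ⟨m, by ring⟩]
    have h4 : q ^ ((m + n) ^ 2) * q ^ ((m - n) ^ 2) = (q ^ 2) ^ (m ^ 2) * (q ^ 2) ^ (n ^ 2) := by
      rw [← zpow_add₀ hq0, sq q]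
      simp only [mul_zpow, ← zpow_add₀ hq0]
      ring_nf
    simp only [Function.comp, g]
    linear_combination (1 + (-1 : ℂ) ^ (m + n) * (-1) ^ (m - n)) * h4 +
      (q ^ 2) ^ (m ^ 2) * (q ^ 2) ^ (n ^ 2) * h3

lemma theta_sq_sub_sq (hq0 : q ≠ 0) (ha : HasSum (fun k : ℤ ↦ q ^ (k ^ 2)) a)
    (hb : HasSum (fun k : ℤ ↦ q ^ (k ^ 2) * (-1) ^ k) b)
    (hd : HasSum (fun k : ℤ ↦ (q ^ 2) ^ (k ^ 2) * (q ^ 2) ^ k) d) :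
    a * a - b * b = 2 * q * (d * d) := by
  have h1 := (ha.mul_of_complex ha).sub (hb.mul_of_complex hb)
  have h2 := (hd.mul_of_complex hd).mul_left (2 * q)
  let g : ℤ × ℤ → ℤ × ℤ := fun p ↦ (p.1 + p.2 + 1, p.1 - p.2)
  have hg : Function.Injective g := by
    rintro ⟨m, n⟩ ⟨m', n'⟩ h
    simp only [g, Prod.mk.injEq] at h ⊢
    lia
  refine ((hg.hasSum_iff ?_).2 h1).unique (h2.congr_fun ?_)
  · rintro ⟨m, n⟩ h
    have heven : Even (m + n) := by
      by_contra hne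
      obtain ⟨r, hr⟩ := Int.not_even_iff_odd.1 hne
      exact h ⟨(r, r - n), by simp only [g, Prod.mk.injEq]; lia⟩
    have : (-1 : ℂ) ^ m * (-1) ^ n = 1 := by
      rw [← zpow_add₀ (by norm_num), heven.neg_one_zpow]
    linear_combination -q ^ (m ^ 2) * q ^ (n ^ 2) * this
  · rintro ⟨m, n⟩
    have h3 : (-1 : ℂ) ^ (m + n + 1) * (-1) ^ (m - n) = -1 := by
      rw [← zpow_add₀ (by norm_num), Odd.neg_one_zpow ⟨m, by ring⟩]
    have h4 : q ^ ((m + n + 1) ^ 2) * q ^ ((m - n) ^ 2) =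
        q * ((q ^ 2) ^ (m ^ 2) * (q ^ 2) ^ m * ((q ^ 2) ^ (n ^ 2) * (q ^ 2) ^ n)) := by
      rw [sq q]
      simp only [mul_zpow, ← zpow_add₀ hq0, ← zpow_one_add₀ hq0]
      ring_nf
    simp only [Function.comp, g]
    linear_combination (1 - (-1 : ℂ) ^ (m + n + 1) * (-1) ^ (m - n)) * h4 -
      q * ((q ^ 2) ^ (m ^ 2) * (q ^ 2) ^ m * ((q ^ 2) ^ (n ^ 2) * (q ^ 2) ^ n)) * h3

end Theta

/-- Jacobi's *aequatio identica satis abstrusa*. -/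
lemma jacobi_quartic {q : ℂ} (hq : ‖q‖ < 1) (hq0 : q ≠ 0) :
    qProd q (q ^ 2) ^ 8 - 16 * q * qProd (q ^ 2) (q ^ 2) ^ 8 = qProd (-q) (q ^ 2) ^ 8 := by
  have hp := norm_sq_lt_one hq
  have hp0 : q ^ 2 ≠ 0 := pow_ne_zero _ hq0
  have hp2 := norm_sq_lt_one hp
  have hD : qProd (-q ^ 2) (q ^ 2) ≠ 0 :=
    qProd_ne_zero hp (one_add_mul_pow_ne_zero (by simpa using hp) hp.le)
  have ha := hasSum_triple_product hq hq0 one_ne_zero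
  have hb := hasSum_triple_product hq hq0 (neg_ne_zero.2 one_ne_zero)
  have hc := hasSum_triple_product hp hp0 one_ne_zero
  have hd := hasSum_triple_product hp hp0 hp0
  simp only [one_zpow, mul_one, inv_one, one_mul, inv_neg, neg_mul] at ha hb hc
  have h1 := theta_sq_add_sq hq0 ha hb hc
  have h2 := theta_sq_sub_sq hq0 ha hb hd
  rw [inv_mul_cancel₀ hp0, qProd_eq_mul 1 hp2, one_mul, ← sq (q ^ 2)] at h2
  have h3 := qProd_even_odd (q ^ 2) hp
  rw [← sq (q ^ 2)] at h3
  have h4 := qProd_mul_neg (q ^ 2) hp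
  generalize qProd q (q ^ 2) = A at *
  generalize qProd (-q) (q ^ 2) = C at *
  generalize qProd (-q ^ 2) (q ^ 2) = D at *
  generalize qProd (q ^ 2) (q ^ 2) = B at *
  generalize qProd (-(q ^ 2) ^ 2) ((q ^ 2) ^ 2) = D' at *
  generalize qProd (q ^ 2) ((q ^ 2) ^ 2) = A' at *
  generalize qProd ((q ^ 2) ^ 2) ((q ^ 2) ^ 2) = B' at *
  refine mul_left_cancel₀ (pow_ne_zero 4 hD) ?_
  have h5 : D' ^ 4 * (A' * B') ^ 4 = D ^ 4 * B ^ 8 := by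
    rw [← h3, ← h4]; ring
  linear_combination (D * (A * A) * (D * (A * A)) - D * (C * C) * (D * (C * C))) * h1 +
    2 * (D' * (A' * A') * (D' * (A' * A'))) * h2 + 16 * q * h5

lemma differentiableOn_qProd_pow (j : ℕ) :
    DifferentiableOn ℂ (fun z ↦ qProd (z ^ j) (z ^ 2)) (ball 0 1) := by
  have h : HasProdLocallyUniformlyOn (fun (n : ℕ) (z : ℂ) ↦ 1 + z ^ j * (z ^ 2) ^ n)
      (fun z ↦ qProd (z ^ j) (z ^ 2)) (ball 0 1) := by
    refine hasProdLocallyUniformlyOn_of_forall_compact isOpen_ball fun K hK hcK ↦ ?_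
    rcases K.eq_empty_or_nonempty with rfl | hN
    · simpa [hasProdUniformlyOn_iff_tendstoUniformlyOn] using tendstoUniformlyOn_empty
    obtain ⟨w, hw, hmax⟩ := hcK.exists_isMaxOn hN (continuous_norm.continuousOn (s := K))
    have hw1 : ‖w‖ < 1 := by simpa using hK hw
    refine (summable_geometric_of_lt_one (norm_nonneg _)
      (norm_sq_lt_one hw1)).hasProdUniformlyOn_nat_one_add hcK
      (.of_forall fun n z hz ↦ ?_) (fun _ ↦ by fun_prop)
    have hzw : ‖z‖ ≤ ‖w‖ := hmax hz
    rw [norm_mul, norm_pow, norm_pow, norm_pow, norm_pow]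
    calc ‖z‖ ^ j * (‖z‖ ^ 2) ^ n ≤ 1 * (‖w‖ ^ 2) ^ n := by
          gcongr
          exact pow_le_one₀ (norm_nonneg _) (hzw.trans hw1.le)
      _ = _ := one_mul _
  exact h.differentiableOn (.of_forall fun _ ↦ by
    simpa [Finset.prod_fn] using DifferentiableOn.finsetProd (fun _ _ ↦ by fun_prop)) isOpen_ball

lemma qProd_self_sq_ne_zero {z : ℂ} (hz : ‖z‖ < 1) : qProd z (z ^ 2) ≠ 0 :=
  qProd_ne_zero (norm_sq_lt_one hz) (one_add_mul_pow_ne_zero hz (norm_sq_lt_one hz).le)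

lemma qProd_sq_sq_ne_zero {z : ℂ} (hz : ‖z‖ < 1) : qProd (z ^ 2) (z ^ 2) ≠ 0 :=
  have hp := norm_sq_lt_one hz
  qProd_ne_zero hp (one_add_mul_pow_ne_zero hp hp.le)

lemma modularJ_eq {z : ℂ} (hz : ‖z‖ < 1) :
    modularJ z = 16 * z * (qProd (z ^ 2) (z ^ 2) / qProd z (z ^ 2)) ^ 8 := by
  have hp := norm_sq_lt_one hz
  have h := (((hasProd_qProd (z ^ 2) hp).div₀ (hasProd_qProd z hp)
    (qProd_self_sq_ne_zero hz)).pow 8).tprod_eq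
  rw [modularJ, ← h]
  congr 1
  refine tprod_congr fun n ↦ ?_
  rw [show 2 * (n + 1) - 1 = 2 * n + 1 by lia]
  ring_nf

/-- The modular function `J(z) = 16z ∏ ((1+z^{2n})/(1+z^{2n-1}))^8` is analytic on the
unit disk, vanishes only at `0`, and omits the values `0` and `1` on `0 < |z| < 1`. -/
theorem modularJ_analytic_and_omits :
    AnalyticOn ℂ modularJ (ball (0 : ℂ) 1) ∧
    (∀ z ∈ ball (0 : ℂ) 1, modularJ z = 0 ↔ z = 0) ∧
    (∀ z ∈ ball (0 : ℂ) 1, z ≠ 0 → modularJ z ≠ 0 ∧ modularJ z ≠ 1) := by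
  have hzero (z : ℂ) (hz : z ∈ ball (0 : ℂ) 1) : modularJ z = 0 ↔ z = 0 := by
    rw [mem_ball_zero_iff] at hz
    simp [modularJ_eq hz, qProd_self_sq_ne_zero hz, qProd_sq_sq_ne_zero hz]
  refine ⟨?_, hzero, fun z hz hz0 ↦ ⟨fun h ↦ hz0 ((hzero z hz).1 h), fun h ↦ ?_⟩⟩
  · refine (DifferentiableOn.analyticOnNhd ?_ isOpen_ball).analyticOn
    have hA : DifferentiableOn ℂ (fun z ↦ qProd z (z ^ 2)) (ball 0 1) := by
      simpa using differentiableOn_qProd_pow 1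
    have hdiv := (differentiableOn_qProd_pow 2).fun_div hA
      fun z hz ↦ qProd_self_sq_ne_zero (mem_ball_zero_iff.1 hz)
    exact ((differentiableOn_id.const_mul (16 : ℂ)).fun_mul (hdiv.fun_pow 8)).congr
      fun z hz ↦ modularJ_eq (mem_ball_zero_iff.1 hz)
  · rw [mem_ball_zero_iff] at hz
    have hA := qProd_self_sq_ne_zero hz
    have hC : qProd (-z) (z ^ 2) ≠ 0 := by simpa using qProd_self_sq_ne_zero (z := -z) (by simpa)
    rw [modularJ_eq hz, div_pow, mul_div_assoc', div_eq_one_iff_eq (pow_ne_zero 8 hA)] at h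
    refine pow_ne_zero 8 hC ?_
    rw [← jacobi_quartic hz hz0, h, sub_self]
end
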